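/- Let R be a commutative ring, S a multiplicatively closed subset of R containing 1, and P an S-ideal of R. If Q is a prime ideal of R that is minimal over P (i.e., Q is a minimal element of the set of prime ideals of R containing P), then Q is an S-ideal of R. -/

import Mathlib

/-- A subset `S` of a commutative ring is multiplicatively closed:
nonempty and closed under multiplication. -/
def MulClosed {R : Type*} [CommRing R] (S : Set R) : Prop :=
  S.Nonempty ∧ ∀ x ∈ S, ∀ y ∈ S, x * y ∈ S

/-- A proper ideal `P` is an `S`-ideal if `x * y ∈ P` and `x ∈ S` imply `y ∈ P`. -/
def SIdeal {R : Type*} [CommRing R] (S : Set R) (P : Ideal R) : Prop :=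
  P ≠ ⊤ ∧ ∀ x y : R, x * y ∈ P → x ∈ S → y ∈ P
theorem stmt_6 {R : Type*} [CommRing R] (S : Set R) (P Q : Ideal R)
    (hS : MulClosed S) (h1 : (1 : R) ∈ S) (hP : SIdeal S P)
    (hQ : Q ∈ P.minimalPrimes) :
    SIdeal S Q := by
  refine ⟨hQ.1.1.ne_top, fun x y hxy hx => ?_⟩
  refine (hQ.1.1.mem_or_mem hxy).resolve_left fun hxQ => ?_
  obtain ⟨z, hz, hxz⟩ := Ideal.exists_mul_mem_of_mem_minimalPrimes hQ hxQ
  exact hz (hP.2 x z hxz hx)
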